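/- Let β = log 5/log 2 and let ℓ ≥ 1. The smallest eigenvalue of the Neumann Laplacian −Δ^{𝔾_ℓ,N} on ℓ²(𝔾_ℓ) is 0, and its smallest non-zero eigenvalue E₁ satisfies (15/2)·2^{−ℓβ} ≤ E₁ ≤ 60·2^{−ℓβ}. -/

import Mathlib

open scoped Classical

noncomputable section

namespace SGL

/-- The vector `a₂ = (1,0)`. -/
def a2 : ℝ × ℝ := (1, 0)

/-- The vector `a₃ = (1/2, √3/2)`. -/
def a3 : ℝ × ℝ := (1/2, Real.sqrt 3 / 2)

/-- The vertex set of the unit triangle with lower-left corner `t`. -/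
def tri (t : ℝ × ℝ) : Finset (ℝ × ℝ) := {t, t + a2, t + a3}

/-- The lower-left corners of the unit triangles making up `Tₙ`:
`T_{n+1} = T_n ∪ (T_n + 2ⁿ a₂) ∪ (T_n + 2ⁿ a₃)`. -/
def baseSet : ℕ → Finset (ℝ × ℝ)
  | 0 => {(0, 0)}
  | (n+1) => baseSet n ∪ (baseSet n).image (· + (2 ^ n : ℝ) • a2)
      ∪ (baseSet n).image (· + (2 ^ n : ℝ) • a3)

/-- `𝔾ₙ`: the set of all vertices of the unit triangles composing `Tₙ`. -/
def VtxF (n : ℕ) : Finset (ℝ × ℝ) := (baseSet n).biUnion tri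

/-- Reflection across the `y`-axis. -/
def reflY (p : ℝ × ℝ) : ℝ × ℝ := (-p.1, p.2)

/-- `(x,y) ∈ ℰₙ`: `x ≠ y` lie in a common unit triangle of `Tₙ`. -/
def EdgeIn (n : ℕ) (x y : ℝ × ℝ) : Prop :=
  ∃ t ∈ baseSet n, x ∈ tri t ∧ y ∈ tri t ∧ x ≠ y

/-- Adjacency in the full Sierpinski lattice: an edge of some `ℰₙ` or of its mirror `ℰₙ′`. -/
def Adj (x y : ℝ × ℝ) : Prop :=
  (∃ n, EdgeIn n x y) ∨ (∃ n, EdgeIn n (reflY x) (reflY y))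

/-- The vertex set `𝔾 = ⋃ₙ (𝔾ₙ ∪ 𝔾ₙ′)` of the full Sierpinski lattice. -/
def SG : Set (ℝ × ℝ) :=
  (⋃ n, (VtxF n : Set (ℝ × ℝ))) ∪ reflY '' (⋃ n, (VtxF n : Set (ℝ × ℝ)))

/-- The type of vertices of the Sierpinski lattice. -/
abbrev Gpt := {p : ℝ × ℝ // p ∈ SG}

/-- `ℓ²(𝔾)` with real coefficients. -/
abbrev l2G := lp (fun _ : Gpt => ℝ) 2

/-- The essential support of a measure on `ℝ`. -/
def essSupp (P₀ : MeasureTheory.Measure ℝ) : Set ℝ :=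
  {t : ℝ | ∀ ε > 0, 0 < P₀ (Set.Ioo (t - ε) (t + ε))}

end SGL

end

namespace SGL

/-- Degree of `x` in the full Sierpinski lattice `𝔾`. -/
noncomputable def degG (x : ℝ × ℝ) : ℕ := Set.ncard {y : ℝ × ℝ | Adj x y}

/-- Degree of `x` within the subgraph induced by the finite vertex set `A`. -/
noncomputable def degIn (A : Finset (ℝ × ℝ)) (x : ℝ × ℝ) : ℕ :=
  (A.filter fun y => Adj x y).card

/-- Diagonal term for the three boundary conditions: `0 = S` (simple, i.e. `deg(x)`),
`1 = N` (Neumann, i.e. `deg_A(x)`), `2 = D` (modified Dirichlet, i.e. `2deg(x) − deg_A(x)`). -/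
noncomputable def bcDiag : Fin 3 → Finset (ℝ × ℝ) → (ℝ × ℝ) → ℝ
  | 0, _, x => (degG x : ℝ)
  | 1, A, x => (degIn A x : ℝ)
  | 2, A, x => 2 * (degG x : ℝ) - (degIn A x : ℝ)

/-- The matrix of `H^{A,•} = −Δ^{A,•} + V|_A` acting on `ℓ²(A)`, for boundary condition `b`. -/
noncomputable def HMat (b : Fin 3) (A : Finset (ℝ × ℝ)) (V : ℝ × ℝ → ℝ) :
    Matrix A A ℝ := fun x y =>
  (if (x : ℝ × ℝ) = (y : ℝ × ℝ) then bcDiag b A (x : ℝ × ℝ) + V (x : ℝ × ℝ) else 0)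
    - (if Adj (x : ℝ × ℝ) (y : ℝ × ℝ) then 1 else 0)

/-- The eigenvalue counting function `𝒩(E;M)`: the number of eigenvalues of `M` that are
`≤ E`, counted with multiplicity (the dimension of the span of the eigenspaces with
eigenvalue `≤ E`; for symmetric `M` this is the usual count). -/
noncomputable def evCount {ι : Type} [Fintype ι] (M : Matrix ι ι ℝ) (E : ℝ) : ℕ :=
  Module.finrank ℝ
    ↥(⨆ μ : {μ : ℝ // μ ≤ E}, Module.End.eigenspace (Matrix.mulVecLin M) (μ : ℝ))

/-- The three corner (extreme) vertices of `𝔾_ℓ`. -/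
noncomputable def cornerF (ℓ : ℕ) : Finset (ℝ × ℝ) :=
  {(0, 0), (2 ^ ℓ : ℝ) • a2, (2 ^ ℓ : ℝ) • a3}

/-- The truncated triangle `G̃_ℓ = 𝔾_ℓ` minus its three extreme vertices. -/
noncomputable def TruncF (ℓ : ℕ) : Finset (ℝ × ℝ) := VtxF ℓ \ cornerF ℓ

end SGL

namespace SGL

/-- The vertices, in lattice coordinates, of the unit triangle with lower-left corner `t`. -/
def cell (t : ℕ × ℕ) : Finset (ℕ × ℕ) := {t, (t.1 + 1, t.2), (t.1, t.2 + 1)}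

/-- The lattice coordinates of the unit triangles of `Tₙ`, obtained by subdividing every triangle
of the previous level. -/
def cells : ℕ → Finset (ℕ × ℕ)
  | 0 => {(0, 0)}
  | (n + 1) => (cells n).biUnion fun t =>
      {(2 * t.1, 2 * t.2), (2 * t.1 + 1, 2 * t.2), (2 * t.1, 2 * t.2 + 1)}

/-- The lattice coordinates of the vertices of `Tₙ`. -/
def verts (n : ℕ) : Finset (ℕ × ℕ) := (cells n).biUnion cell

/-- The triangles of `Tₙ` containing the vertex `v`. -/
def cellsAt (n : ℕ) (v : ℕ × ℕ) : Finset (ℕ × ℕ) := (cells n).filter (v ∈ cell ·)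

/-- The sum of `f` over the vertices of a unit triangle. -/
def cellSum (f : ℕ × ℕ → ℝ) (t : ℕ × ℕ) : ℝ := f t + f (t.1 + 1, t.2) + f (t.1, t.2 + 1)

/-- The Neumann Laplacian of `Tₙ` in lattice coordinates, as a sum over triangles. -/
def latLap (n : ℕ) (f : ℕ × ℕ → ℝ) (v : ℕ × ℕ) : ℝ :=
  ∑ t ∈ cellsAt n v, (3 * f v - cellSum f t)

/-- The eigenvalue equation on `Tₙ` in which a vertex in two triangles has mass `1` and a corner
has mass `1 / 2 + τ`. -/
def CornerEigen (n : ℕ) (μ τ : ℝ) (f : ℕ × ℕ → ℝ) : Prop :=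
  ∀ v ∈ verts n, latLap n f v =
    μ * ((cellsAt n v).card / 2 + τ * (2 - (cellsAt n v).card)) * f v

lemma mem_cell {v t : ℕ × ℕ} :
    v ∈ cell t ↔ v = t ∨ v = (t.1 + 1, t.2) ∨ v = (t.1, t.2 + 1) := by
  simp [cell]

lemma mem_cells_succ {n : ℕ} {s : ℕ × ℕ} :
    s ∈ cells (n + 1) ↔ ∃ t ∈ cells n, s = (2 * t.1, 2 * t.2) ∨ s = (2 * t.1 + 1, 2 * t.2) ∨
      s = (2 * t.1, 2 * t.2 + 1) := by
  simp [cells]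

lemma mem_verts {n : ℕ} {v : ℕ × ℕ} : v ∈ verts n ↔ ∃ t ∈ cells n, v ∈ cell t := by
  simp [verts]

lemma mem_cellsAt {n : ℕ} {v t : ℕ × ℕ} : t ∈ cellsAt n v ↔ t ∈ cells n ∧ v ∈ cell t := by
  simp [cellsAt]

lemma even_even_mem_cells {n i j : ℕ} : (2 * i, 2 * j) ∈ cells (n + 1) ↔ (i, j) ∈ cells n := by
  rw [mem_cells_succ]
  constructor
  · rintro ⟨⟨a, b⟩, h, e | e | e⟩ <;> simp only [Prod.mk.injEq] at e
    · obtain ⟨rfl, rfl⟩ : a = i ∧ b = j := by omega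
      exact h
    all_goals omega
  · exact fun h => ⟨_, h, Or.inl rfl⟩

lemma odd_even_mem_cells {n i j : ℕ} :
    (2 * i + 1, 2 * j) ∈ cells (n + 1) ↔ (i, j) ∈ cells n := by
  rw [mem_cells_succ]
  constructor
  · rintro ⟨⟨a, b⟩, h, e | e | e⟩ <;> simp only [Prod.mk.injEq] at e
    · omega
    · obtain ⟨rfl, rfl⟩ : a = i ∧ b = j := by omega
      exact h
    · omega
  · exact fun h => ⟨_, h, Or.inr (Or.inl rfl)⟩

lemma even_odd_mem_cells {n i j : ℕ} :
    (2 * i, 2 * j + 1) ∈ cells (n + 1) ↔ (i, j) ∈ cells n := by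
  rw [mem_cells_succ]
  constructor
  · rintro ⟨⟨a, b⟩, h, e | e | e⟩ <;> simp only [Prod.mk.injEq] at e
    · omega
    · omega
    · obtain ⟨rfl, rfl⟩ : a = i ∧ b = j := by omega
      exact h
  · exact fun h => ⟨_, h, Or.inr (Or.inr rfl)⟩

lemma cellsAt_double (n : ℕ) (v : ℕ × ℕ) :
    cellsAt (n + 1) (2 * v.1, 2 * v.2) = (cellsAt n v).image (· + v) := by
  obtain ⟨i, j⟩ := v
  ext ⟨a, b⟩
  simp only [mem_cellsAt, Finset.mem_image, mem_cell, mem_cells_succ, Prod.mk.injEq, Prod.exists,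
    Prod.mk_add_mk]
  constructor
  · rintro ⟨⟨c, d, h, h1⟩, h2⟩
    refine ⟨c, d, ⟨h, ?_⟩, ?_⟩ <;> omega
  · rintro ⟨c, d, ⟨h, h1⟩, h2⟩
    refine ⟨⟨c, d, h, ?_⟩, ?_⟩ <;> omega

lemma cellsAt_bottom {n : ℕ} {t : ℕ × ℕ} (ht : t ∈ cells n) :
    cellsAt (n + 1) (2 * t.1 + 1, 2 * t.2) =
      {(2 * t.1, 2 * t.2), (2 * t.1 + 1, 2 * t.2)} := by
  obtain ⟨i, j⟩ := t
  ext ⟨a, b⟩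
  simp only [mem_cellsAt, mem_cell, Finset.mem_insert, Finset.mem_singleton, Prod.mk.injEq]
  constructor
  · rintro ⟨h, h1⟩
    rw [mem_cells_succ] at h
    simp only [Prod.mk.injEq, Prod.exists] at h
    obtain ⟨c, d, -, h2⟩ := h
    omega
  · rintro (⟨rfl, rfl⟩ | ⟨rfl, rfl⟩)
    · exact ⟨even_even_mem_cells.2 ht, by omega⟩
    · exact ⟨odd_even_mem_cells.2 ht, by omega⟩

lemma cellsAt_left {n : ℕ} {t : ℕ × ℕ} (ht : t ∈ cells n) :
    cellsAt (n + 1) (2 * t.1, 2 * t.2 + 1) =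
      {(2 * t.1, 2 * t.2), (2 * t.1, 2 * t.2 + 1)} := by
  obtain ⟨i, j⟩ := t
  ext ⟨a, b⟩
  simp only [mem_cellsAt, mem_cell, Finset.mem_insert, Finset.mem_singleton, Prod.mk.injEq]
  constructor
  · rintro ⟨h, h1⟩
    rw [mem_cells_succ] at h
    simp only [Prod.mk.injEq, Prod.exists] at h
    obtain ⟨c, d, -, h2⟩ := h
    omega
  · rintro (⟨rfl, rfl⟩ | ⟨rfl, rfl⟩)
    · exact ⟨even_even_mem_cells.2 ht, by omega⟩
    · exact ⟨even_odd_mem_cells.2 ht, by omega⟩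

lemma cellsAt_right {n : ℕ} {t : ℕ × ℕ} (ht : t ∈ cells n) :
    cellsAt (n + 1) (2 * t.1 + 1, 2 * t.2 + 1) =
      {(2 * t.1 + 1, 2 * t.2), (2 * t.1, 2 * t.2 + 1)} := by
  obtain ⟨i, j⟩ := t
  ext ⟨a, b⟩
  simp only [mem_cellsAt, mem_cell, Finset.mem_insert, Finset.mem_singleton, Prod.mk.injEq]
  constructor
  · rintro ⟨h, h1⟩
    rw [mem_cells_succ] at h
    simp only [Prod.mk.injEq, Prod.exists] at h
    obtain ⟨c, d, -, h2⟩ := h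
    omega
  · rintro (⟨rfl, rfl⟩ | ⟨rfl, rfl⟩)
    · exact ⟨odd_even_mem_cells.2 ht, by omega⟩
    · exact ⟨even_odd_mem_cells.2 ht, by omega⟩

lemma verts_succ_cases {n : ℕ} {w : ℕ × ℕ} (hw : w ∈ verts (n + 1)) :
    (∃ v ∈ verts n, w = (2 * v.1, 2 * v.2)) ∨ ∃ t ∈ cells n, w = (2 * t.1 + 1, 2 * t.2) ∨
      w = (2 * t.1, 2 * t.2 + 1) ∨ w = (2 * t.1 + 1, 2 * t.2 + 1) := by
  obtain ⟨s, hs, hws⟩ := mem_verts.1 hw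
  obtain ⟨⟨a, b⟩, ht, hst⟩ := mem_cells_succ.1 hs
  rw [mem_cell] at hws
  have h0 : (a, b) ∈ verts n := mem_verts.2 ⟨_, ht, by simp [mem_cell]⟩
  have h1 : (a + 1, b) ∈ verts n := mem_verts.2 ⟨_, ht, by simp [mem_cell]⟩
  have h2 : (a, b + 1) ∈ verts n := mem_verts.2 ⟨_, ht, by simp [mem_cell]⟩
  rcases hst with rfl | rfl | rfl <;> rcases hws with rfl | rfl | rfl
  · exact Or.inl ⟨_, h0, rfl⟩
  · exact Or.inr ⟨_, ht, Or.inl rfl⟩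
  · exact Or.inr ⟨_, ht, Or.inr (Or.inl rfl)⟩
  · exact Or.inr ⟨_, ht, Or.inl rfl⟩
  · exact Or.inl ⟨_, h1, rfl⟩
  · exact Or.inr ⟨_, ht, Or.inr (Or.inr rfl)⟩
  · exact Or.inr ⟨_, ht, Or.inr (Or.inl rfl)⟩
  · exact Or.inr ⟨_, ht, Or.inr (Or.inr rfl)⟩
  · exact Or.inl ⟨_, h2, rfl⟩

lemma double_mem_verts {n : ℕ} {v : ℕ × ℕ} (hv : v ∈ verts n) :
    (2 * v.1, 2 * v.2) ∈ verts (n + 1) := by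
  obtain ⟨⟨a, b⟩, ht, hvt⟩ := mem_verts.1 hv
  rcases mem_cell.1 hvt with rfl | rfl | rfl
  · exact mem_verts.2 ⟨_, even_even_mem_cells.2 ht, by simp [mem_cell]⟩
  · exact mem_verts.2 ⟨_, odd_even_mem_cells.2 ht, by simp [mem_cell]; omega⟩
  · exact mem_verts.2 ⟨_, even_odd_mem_cells.2 ht, by simp [mem_cell]; omega⟩

lemma card_cellsAt_double (n : ℕ) (v : ℕ × ℕ) :
    (cellsAt (n + 1) (2 * v.1, 2 * v.2)).card = (cellsAt n v).card := by
  rw [cellsAt_double, Finset.card_image_of_injective _ (add_left_injective v)]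

lemma card_cellsAt_le (n : ℕ) : ∀ v ∈ verts n, (cellsAt n v).card ≤ 2 := by
  induction n with
  | zero =>
    intro v _
    exact (Finset.card_filter_le _ _).trans (by simp [cells])
  | succ n ih =>
    intro w hw
    rcases verts_succ_cases hw with ⟨v, hv, rfl⟩ | ⟨t, ht, rfl | rfl | rfl⟩
    · rw [card_cellsAt_double]
      exact ih v hv
    · rw [cellsAt_bottom ht]
      exact Finset.card_le_two
    · rw [cellsAt_left ht]
      exact Finset.card_le_two
    · rw [cellsAt_right ht]
      exact Finset.card_le_two

lemma midpoint_equations {n : ℕ} {μ τ : ℝ} {f : ℕ × ℕ → ℝ} (hf : CornerEigen (n + 1) μ τ f)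
    {t : ℕ × ℕ} (ht : t ∈ cells n) :
    (4 - μ) * f (2 * t.1 + 1, 2 * t.2) = f (2 * t.1, 2 * t.2) + f (2 * (t.1 + 1), 2 * t.2) +
        f (2 * t.1, 2 * t.2 + 1) + f (2 * t.1 + 1, 2 * t.2 + 1) ∧
    (4 - μ) * f (2 * t.1, 2 * t.2 + 1) = f (2 * t.1, 2 * t.2) + f (2 * t.1, 2 * (t.2 + 1)) +
        f (2 * t.1 + 1, 2 * t.2) + f (2 * t.1 + 1, 2 * t.2 + 1) ∧
    (4 - μ) * f (2 * t.1 + 1, 2 * t.2 + 1) = f (2 * (t.1 + 1), 2 * t.2) +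
        f (2 * t.1, 2 * (t.2 + 1)) + f (2 * t.1 + 1, 2 * t.2) + f (2 * t.1, 2 * t.2 + 1) := by
  have e1 : 2 * (t.1 + 1) = 2 * t.1 + 1 + 1 := by ring
  have e2 : 2 * (t.2 + 1) = 2 * t.2 + 1 + 1 := by ring
  have h0 := even_even_mem_cells.2 ht
  have h1 := odd_even_mem_cells.2 ht
  have b := hf (2 * t.1 + 1, 2 * t.2) (mem_verts.2 ⟨_, h1, by simp [mem_cell]⟩)
  have l := hf (2 * t.1, 2 * t.2 + 1) (mem_verts.2 ⟨_, h0, by simp [mem_cell]⟩)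
  have r := hf (2 * t.1 + 1, 2 * t.2 + 1) (mem_verts.2 ⟨_, h1, by simp [mem_cell]⟩)
  rw [latLap, cellsAt_bottom ht, Finset.sum_pair (by simp), Finset.card_pair (by simp)] at b
  rw [latLap, cellsAt_left ht, Finset.sum_pair (by simp), Finset.card_pair (by simp)] at l
  rw [latLap, cellsAt_right ht, Finset.sum_pair (by simp), Finset.card_pair (by simp)] at r
  simp only [cellSum, Nat.cast_ofNat] at b l r
  rw [e1, e2]
  refine ⟨?_, ?_, ?_⟩ <;> linarith

lemma midpoint_values {μ x y z p q r : ℝ}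
    (hp : (4 - μ) * p = x + y + q + r) (hq : (4 - μ) * q = x + z + p + r)
    (hr : (4 - μ) * r = y + z + p + q) :
    (2 - μ) * (5 - μ) * p = (4 - μ) * (x + y) + 2 * z := by
  have hs : (2 - μ) * (p + q + r) = 2 * (x + y + z) := by linarith
  linear_combination (2 - μ) * hp + hs

/-- Spectral decimation: an eigenfunction at level `n + 1` with eigenvalue `μ < 2` restricts to an
eigenfunction at level `n` with eigenvalue `μ (5 - μ)`. -/
lemma CornerEigen.restrict {n : ℕ} {μ τ : ℝ} {f : ℕ × ℕ → ℝ} (hf : CornerEigen (n + 1) μ τ f)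
    (h2 : μ < 2) :
    CornerEigen n (μ * (5 - μ)) (τ * ((2 - μ) / (6 - μ))) (fun v => f (2 * v.1, 2 * v.2)) := by
  intro v hv
  have hfv := hf _ (double_mem_verts hv)
  rw [card_cellsAt_double, latLap, cellsAt_double,
    Finset.sum_image (fun _ _ _ _ h => add_left_injective v h)] at hfv
  have key : ∀ t ∈ cellsAt n v,
      (2 - μ) * (5 - μ) * (3 * f (2 * v.1, 2 * v.2) - cellSum f (t + v)) =
        (6 - μ) * (3 * f (2 * v.1, 2 * v.2) - cellSum (fun w => f (2 * w.1, 2 * w.2)) t) -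
        2 * μ * (5 - μ) * f (2 * v.1, 2 * v.2) := by
    intro t ht
    obtain ⟨ht, hvt⟩ := mem_cellsAt.1 ht
    obtain ⟨b, l, r⟩ := midpoint_equations hf ht
    have hb := midpoint_values b l r
    have hl := midpoint_values l b (by linarith)
    have hr := midpoint_values (μ := μ) (x := f (2 * (t.1 + 1), 2 * t.2))
      (y := f (2 * t.1, 2 * (t.2 + 1))) (z := f (2 * t.1, 2 * t.2))
      (p := f (2 * t.1 + 1, 2 * t.2 + 1)) (q := f (2 * t.1 + 1, 2 * t.2))
      (r := f (2 * t.1, 2 * t.2 + 1)) (by linarith) (by linarith) (by linarith)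
    obtain ⟨i, j⟩ := t
    simp only [mem_cell] at hvt
    simp only [cellSum] at *
    rcases hvt with rfl | rfl | rfl
    · have e : ((i, j) + (i, j) : ℕ × ℕ) = (2 * i, 2 * j) := by ext <;> simp <;> ring
      rw [e]
      dsimp only at *
      linear_combination -hb - hl
    · have e : ((i, j) + (i + 1, j) : ℕ × ℕ) = (2 * i + 1, 2 * j) := by ext <;> simp <;> ring
      rw [e]
      dsimp only at *
      rw [show 2 * i + 1 + 1 = 2 * (i + 1) by ring]
      linear_combination -hb - hr
    · have e : ((i, j) + (i, j + 1) : ℕ × ℕ) = (2 * i, 2 * j + 1) := by ext <;> simp <;> ring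
      rw [e]
      dsimp only at *
      rw [show 2 * j + 1 + 1 = 2 * (j + 1) by ring]
      linear_combination -hl - hr
  have hsum := Finset.sum_congr rfl key
  rw [← Finset.mul_sum, hfv, Finset.sum_sub_distrib, ← Finset.mul_sum, Finset.sum_const,
    nsmul_eq_mul] at hsum
  have h6 : (6 - μ) ≠ 0 := by linarith
  have hq : (2 - μ) / (6 - μ) * (6 - μ) = 2 - μ := div_mul_cancel₀ _ h6
  rw [latLap]
  apply mul_left_cancel₀ h6
  linear_combination -hsum - μ * (5 - μ) * τ * (2 - (cellsAt n v).card) *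
    f (2 * v.1, 2 * v.2) * hq

lemma CornerEigen.eq_zero_of_restrict {n : ℕ} {μ τ : ℝ} {f : ℕ × ℕ → ℝ}
    (hf : CornerEigen (n + 1) μ τ f) (h2 : μ < 2) (h0 : ∀ v ∈ verts n, f (2 * v.1, 2 * v.2) = 0) :
    ∀ w ∈ verts (n + 1), f w = 0 := by
  intro w hw
  rcases verts_succ_cases hw with ⟨v, hv, rfl⟩ | ⟨t, ht, h⟩
  · exact h0 v hv
  obtain ⟨b, l, r⟩ := midpoint_equations hf ht
  have hx := h0 t (mem_verts.2 ⟨_, ht, by simp [mem_cell]⟩)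
  have hy := h0 (t.1 + 1, t.2) (mem_verts.2 ⟨_, ht, by simp [mem_cell]⟩)
  have hz := h0 (t.1, t.2 + 1) (mem_verts.2 ⟨_, ht, by simp [mem_cell]⟩)
  dsimp only at hx hy hz
  rw [hx, hy] at b
  rw [hx, hz] at l
  rw [hy, hz] at r
  have h5 : (2 - μ) * (5 - μ) ≠ 0 := by
    apply mul_ne_zero <;> linarith
  have hs : ∀ p q s : ℝ, (4 - μ) * p = q + s → (4 - μ) * q = p + s → (4 - μ) * s = p + q →
      p = 0 := by
    intro p q s hp hq hr
    apply mul_left_cancel₀ h5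
    rw [midpoint_values (x := 0) (y := 0) (z := 0) (q := q) (r := s) (by linarith)
      (by linarith) (by linarith)]
    ring
  rcases h with rfl | rfl | rfl
  · exact hs _ (f (2 * t.1, 2 * t.2 + 1)) (f (2 * t.1 + 1, 2 * t.2 + 1)) (by linarith) (by linarith) (by linarith)
  · exact hs _ (f (2 * t.1 + 1, 2 * t.2)) (f (2 * t.1 + 1, 2 * t.2 + 1)) (by linarith)
      (by linarith) (by linarith)
  · exact hs _ (f (2 * t.1 + 1, 2 * t.2)) (f (2 * t.1, 2 * t.2 + 1)) (by linarith)
      (by linarith) (by linarith)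

lemma mem_verts_zero {v : ℕ × ℕ} : v ∈ verts 0 ↔ v = (0, 0) ∨ v = (1, 0) ∨ v = (0, 1) := by
  simp [mem_verts, mem_cell, cells]

lemma cornerEigen_zero {μ τ : ℝ} {f : ℕ × ℕ → ℝ} (hf : CornerEigen 0 μ τ f) :
    ∀ v ∈ verts 0, 3 * f v - (f (0, 0) + f (1, 0) + f (0, 1)) = μ * (1 / 2 + τ) * f v := by
  intro v hv
  have h := hf v hv
  have e : cellsAt 0 v = {(0, 0)} := by
    ext t
    simp only [mem_cellsAt, cells, Finset.mem_singleton]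
    refine ⟨fun h => h.1, ?_⟩
    rintro rfl
    exact ⟨rfl, mem_cell.2 (mem_verts_zero.1 hv)⟩
  rw [latLap, e, Finset.sum_singleton, Finset.card_singleton] at h
  simp only [cellSum, zero_add, Nat.cast_one] at h
  rw [h]
  ring

lemma CornerEigen.le_eigenvalue {n : ℕ} : ∀ {μ τ : ℝ} {f : ℕ × ℕ → ℝ},
    CornerEigen (n + 1) μ τ f → 0 < μ → 0 ≤ τ → τ ≤ 1 / 2 → (∃ v ∈ verts (n + 1), f v ≠ 0) →
    3 / 2 * (1 / 5 : ℝ) ^ n ≤ μ := by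
  induction n with
  | zero =>
    intro μ τ f hf hμ hτ hτ' ⟨w, hw, hfw⟩
    by_contra! hlt
    rw [pow_zero, mul_one] at hlt
    have h2 : μ < 2 := by linarith
    have hv : ∃ v ∈ verts 0, f (2 * v.1, 2 * v.2) ≠ 0 := by
      by_contra! h
      exact hfw (hf.eq_zero_of_restrict h2 h w hw)
    have hr := cornerEigen_zero (hf.restrict h2)
    set g : ℕ × ℕ → ℝ := fun v => f (2 * v.1, 2 * v.2) with hg
    set κ := μ * (5 - μ) * (1 / 2 + τ * ((2 - μ) / (6 - μ))) with hκ
    have hq : 0 ≤ (2 - μ) / (6 - μ) := by apply div_nonneg <;> linarith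
    have hκ0 : 0 < κ := by
      have : 0 < 5 - μ := by linarith
      positivity
    have hκ3 : κ < 3 := by
      have h1 : κ ≤ μ * (5 - μ) * (1 / 2 + 1 / 2 * ((2 - μ) / (6 - μ))) := by
        have : 0 < 5 - μ := by linarith
        rw [hκ]
        gcongr
      refine h1.trans_lt ?_
      have h6 : 0 < 6 - μ := by linarith
      have e : μ * (5 - μ) * (1 / 2 + 1 / 2 * ((2 - μ) / (6 - μ))) =
          μ * (5 - μ) * (4 - μ) / (6 - μ) := by
        field_simp
        ring
      rw [e, div_lt_iff₀ h6]
      nlinarith [mul_pos hμ (sub_pos.2 hlt), mul_pos (mul_pos hμ (sub_pos.2 hlt)) hμ,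
        mul_pos (mul_pos hμ (sub_pos.2 hlt)) (sub_pos.2 hlt)]
    have a := hr (0, 0) (by simp [mem_verts_zero])
    have b := hr (1, 0) (by simp [mem_verts_zero])
    have c := hr (0, 1) (by simp [mem_verts_zero])
    have hS : g (0, 0) + g (1, 0) + g (0, 1) = 0 := by
      have : κ * (g (0, 0) + g (1, 0) + g (0, 1)) = 0 := by linarith
      exact (mul_eq_zero.1 this).resolve_left hκ0.ne'
    obtain ⟨v, hv, hgv⟩ := hv
    have h := hr v hv
    rw [hS] at h
    have : (3 - κ) * g v = 0 := by linarith
    rcases mul_eq_zero.1 this with h | h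
    · linarith
    · exact hgv h
  | succ n ih =>
    intro μ τ f hf hμ hτ hτ' ⟨w, hw, hfw⟩
    have hp : (1 / 5 : ℝ) ^ (n + 1) ≤ 1 := pow_le_one₀ (by norm_num) (by norm_num)
    by_cases h2 : μ < 2
    · have hv : ∃ v ∈ verts (n + 1), f (2 * v.1, 2 * v.2) ≠ 0 := by
        by_contra! h
        exact hfw (hf.eq_zero_of_restrict h2 h w hw)
      have hq : 0 ≤ (2 - μ) / (6 - μ) := by apply div_nonneg <;> linarith
      have hq1 : (2 - μ) / (6 - μ) ≤ 1 := by
        rw [div_le_one (by linarith)]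
        linarith
      have := ih (hf.restrict h2) (mul_pos hμ (by linarith)) (mul_nonneg hτ hq)
        (by nlinarith) hv
      rw [pow_succ]
      nlinarith
    · linarith

lemma CornerEigen.const_of_zero {n : ℕ} : ∀ {τ : ℝ} {f : ℕ × ℕ → ℝ},
    CornerEigen n 0 τ f → ∀ v ∈ verts n, f v = f (0, 0) := by
  induction n with
  | zero =>
    intro τ f hf v hv
    have h := cornerEigen_zero hf v hv
    have h0 := cornerEigen_zero hf (0, 0) (by simp [mem_verts_zero])
    linarith
  | succ n ih =>
    intro τ f hf w hw
    have hr := hf.restrict (by norm_num)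
    rw [zero_mul] at hr
    have hc := ih hr
    dsimp only at hc
    rcases verts_succ_cases hw with ⟨v, hv, rfl⟩ | ⟨t, ht, h⟩
    · exact hc v hv
    obtain ⟨b, l, r⟩ := midpoint_equations hf ht
    have hx := hc t (mem_verts.2 ⟨_, ht, by simp [mem_cell]⟩)
    have hy := hc (t.1 + 1, t.2) (mem_verts.2 ⟨_, ht, by simp [mem_cell]⟩)
    have hz := hc (t.1, t.2 + 1) (mem_verts.2 ⟨_, ht, by simp [mem_cell]⟩)
    simp only [mul_zero] at hx hy hz
    rcases h with rfl | rfl | rfl <;> linarith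

/-- The embedding of lattice coordinates into the plane. -/
noncomputable def latPt (p : ℕ × ℕ) : ℝ × ℝ := (p.1 : ℝ) • a2 + (p.2 : ℝ) • a3

lemma latPt_fst (p : ℕ × ℕ) : (latPt p).1 = p.1 + p.2 / 2 := by
  simp [latPt, a2, a3]
  ring

lemma latPt_snd (p : ℕ × ℕ) : (latPt p).2 = p.2 * (√3 / 2) := by
  simp [latPt, a2, a3]

lemma latPt_injective : Function.Injective latPt := by
  intro p q h
  have h1 := congrArg Prod.fst h
  have h2 := congrArg Prod.snd h
  rw [latPt_fst, latPt_fst] at h1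
  rw [latPt_snd, latPt_snd] at h2
  have h3 : (p.2 : ℝ) = q.2 := mul_right_cancel₀ (by positivity) h2
  have h4 : (p.1 : ℝ) = q.1 := by linarith
  exact Prod.ext (by exact_mod_cast h4) (by exact_mod_cast h3)

lemma latPt_add (p q : ℕ × ℕ) : latPt (p + q) = latPt p + latPt q := by
  simp only [latPt, Prod.fst_add, Prod.snd_add, Nat.cast_add, add_smul]
  abel

lemma tri_latPt (t : ℕ × ℕ) : tri (latPt t) = (cell t).image latPt := by
  have h1 : latPt (t.1 + 1, t.2) = latPt t + a2 := by
    rw [show (t.1 + 1, t.2) = t + (1, 0) from rfl, latPt_add]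
    simp [latPt]
  have h2 : latPt (t.1, t.2 + 1) = latPt t + a3 := by
    rw [show (t.1, t.2 + 1) = t + (0, 1) from rfl, latPt_add]
    simp [latPt]
  simp [cell, tri, h1, h2]

lemma mem_cells_succ_outer {n : ℕ} {s : ℕ × ℕ} :
    s ∈ cells (n + 1) ↔ s ∈ cells n ∨ (∃ t ∈ cells n, s = (t.1 + 2 ^ n, t.2)) ∨
      ∃ t ∈ cells n, s = (t.1, t.2 + 2 ^ n) := by
  induction n generalizing s with
  | zero => simp [cells]
  | succ n ih =>
    have e : 2 ^ (n + 1) = 2 * 2 ^ n := pow_succ' 2 n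
    constructor
    · intro h
      obtain ⟨t, ht, hs⟩ := mem_cells_succ.1 h
      rcases ih.1 ht with h | ⟨r, hr, rfl⟩ | ⟨r, hr, rfl⟩
      · exact Or.inl (mem_cells_succ.2 ⟨t, h, hs⟩)
      · refine Or.inr (Or.inl ?_)
        rcases hs with rfl | rfl | rfl
        · exact ⟨_, even_even_mem_cells.2 hr, Prod.ext_iff.2 (by dsimp only; omega)⟩
        · exact ⟨_, odd_even_mem_cells.2 hr, Prod.ext_iff.2 (by dsimp only; omega)⟩
        · exact ⟨_, even_odd_mem_cells.2 hr, Prod.ext_iff.2 (by dsimp only; omega)⟩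
      · refine Or.inr (Or.inr ?_)
        rcases hs with rfl | rfl | rfl
        · exact ⟨_, even_even_mem_cells.2 hr, Prod.ext_iff.2 (by dsimp only; omega)⟩
        · exact ⟨_, odd_even_mem_cells.2 hr, Prod.ext_iff.2 (by dsimp only; omega)⟩
        · exact ⟨_, even_odd_mem_cells.2 hr, Prod.ext_iff.2 (by dsimp only; omega)⟩
    · rintro (h | ⟨t, ht, rfl⟩ | ⟨t, ht, rfl⟩)
      · obtain ⟨t, ht, hs⟩ := mem_cells_succ.1 h
        exact mem_cells_succ.2 ⟨t, ih.2 (Or.inl ht), hs⟩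
      · obtain ⟨r, hr, hs⟩ := mem_cells_succ.1 ht
        refine mem_cells_succ.2 ⟨_, ih.2 (Or.inr (Or.inl ⟨r, hr, rfl⟩)), ?_⟩
        simp only [Prod.ext_iff] at hs ⊢
        omega
      · obtain ⟨r, hr, hs⟩ := mem_cells_succ.1 ht
        refine mem_cells_succ.2 ⟨_, ih.2 (Or.inr (Or.inr ⟨r, hr, rfl⟩)), ?_⟩
        simp only [Prod.ext_iff] at hs ⊢
        omega

lemma add_lt_of_mem_cells {n : ℕ} : ∀ {t : ℕ × ℕ}, t ∈ cells n → t.1 + t.2 < 2 ^ n := by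
  induction n with
  | zero => simp [cells]
  | succ n ih =>
    intro s hs
    obtain ⟨t, ht, h⟩ := mem_cells_succ.1 hs
    have := ih ht
    simp only [Prod.ext_iff] at h
    rw [pow_succ]
    omega

lemma add_le_of_mem_verts {n : ℕ} {v : ℕ × ℕ} (hv : v ∈ verts n) : v.1 + v.2 ≤ 2 ^ n := by
  obtain ⟨t, ht, hvt⟩ := mem_verts.1 hv
  have := add_lt_of_mem_cells ht
  simp only [mem_cell, Prod.ext_iff] at hvt
  omega

lemma cells_mono : Monotone cells :=
  monotone_nat_of_le_succ fun _ _ hs => mem_cells_succ_outer.2 (Or.inl hs)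

lemma mem_cells_of_add_lt {m n : ℕ} {t : ℕ × ℕ} (ht : t ∈ cells m) (hlt : t.1 + t.2 < 2 ^ n) :
    t ∈ cells n := by
  rcases le_total m n with h | h
  · exact cells_mono h ht
  induction m, h using Nat.le_induction with
  | base => exact ht
  | succ m hm ih =>
    have := Nat.pow_le_pow_right (n := 2) (by norm_num) hm
    rcases mem_cells_succ_outer.1 ht with h | ⟨r, -, rfl⟩ | ⟨r, -, rfl⟩
    · exact ih h
    all_goals dsimp only at hlt; omega

lemma baseSet_eq_image (n : ℕ) : baseSet n = (cells n).image latPt := by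
  induction n with
  | zero => simp [baseSet, cells, latPt]
  | succ n ih =>
    have h1 (t : ℕ × ℕ) : latPt (t.1 + 2 ^ n, t.2) = latPt t + (2 ^ n : ℝ) • a2 := by
      rw [show (t.1 + 2 ^ n, t.2) = t + (2 ^ n, 0) from rfl, latPt_add]
      simp [latPt]
    have h2 (t : ℕ × ℕ) : latPt (t.1, t.2 + 2 ^ n) = latPt t + (2 ^ n : ℝ) • a3 := by
      rw [show (t.1, t.2 + 2 ^ n) = t + (0, 2 ^ n) from rfl, latPt_add]
      simp [latPt]
    ext x
    simp only [baseSet, ih, Finset.mem_union, Finset.mem_image, mem_cells_succ_outer]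
    constructor
    · rintro ((⟨t, ht, rfl⟩ | ⟨_, ⟨t, ht, rfl⟩, rfl⟩) | ⟨_, ⟨t, ht, rfl⟩, rfl⟩)
      · exact ⟨t, Or.inl ht, rfl⟩
      · exact ⟨_, Or.inr (Or.inl ⟨t, ht, rfl⟩), h1 t⟩
      · exact ⟨_, Or.inr (Or.inr ⟨t, ht, rfl⟩), h2 t⟩
    · rintro ⟨_, ht | ⟨t, ht, rfl⟩ | ⟨t, ht, rfl⟩, rfl⟩
      · exact Or.inl (Or.inl ⟨_, ht, rfl⟩)
      · exact Or.inl (Or.inr ⟨_, ⟨t, ht, rfl⟩, (h1 t).symm⟩)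
      · exact Or.inr ⟨_, ⟨t, ht, rfl⟩, (h2 t).symm⟩

lemma vtxF_eq_image (n : ℕ) : VtxF n = (verts n).image latPt := by
  rw [VtxF, baseSet_eq_image, verts, Finset.image_biUnion, Finset.biUnion_image]
  simp only [tri_latPt]

lemma latPt_mem_tri {v t : ℕ × ℕ} : latPt v ∈ tri (latPt t) ↔ v ∈ cell t := by
  rw [tri_latPt, latPt_injective.mem_finset_image]

lemma eq_zero_of_reflY_mem_tri {v t : ℕ × ℕ} (h : reflY (latPt v) ∈ tri (latPt t)) :
    v = (0, 0) := by
  rw [tri_latPt, Finset.mem_image] at h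
  obtain ⟨s, -, hs⟩ := h
  have h1 := congrArg Prod.fst hs
  simp only [reflY, latPt_fst] at h1
  have a1 : (0 : ℝ) ≤ s.1 := Nat.cast_nonneg _
  have a2 : (0 : ℝ) ≤ s.2 := Nat.cast_nonneg _
  have a3 : (0 : ℝ) ≤ v.1 := Nat.cast_nonneg _
  have a4 : (0 : ℝ) ≤ v.2 := Nat.cast_nonneg _
  have b1 : (v.1 : ℝ) = 0 := by linarith
  have b2 : (v.2 : ℝ) = 0 := by linarith
  exact Prod.ext (by exact_mod_cast b1) (by exact_mod_cast b2)

lemma adj_latPt_iff {n : ℕ} {v w : ℕ × ℕ} (hv : v ∈ verts n) (hw : w ∈ verts n) :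
    Adj (latPt v) (latPt w) ↔ v ≠ w ∧ ∃ t ∈ cells n, v ∈ cell t ∧ w ∈ cell t := by
  constructor
  · rintro (⟨m, x, hx, h1, h2, h3⟩ | ⟨m, x, hx, h1, h2, h3⟩)
    · rw [baseSet_eq_image, Finset.mem_image] at hx
      obtain ⟨t, ht, rfl⟩ := hx
      rw [latPt_mem_tri] at h1 h2
      have hne : v ≠ w := fun h => h3 (congrArg _ h)
      refine ⟨hne, t, mem_cells_of_add_lt ht ?_, h1, h2⟩
      have h4 := add_le_of_mem_verts hv
      have h5 := add_le_of_mem_verts hw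
      simp only [mem_cell, Prod.ext_iff, ne_eq] at h1 h2 hne
      omega
    · rw [baseSet_eq_image, Finset.mem_image] at hx
      obtain ⟨t, ht, rfl⟩ := hx
      rw [eq_zero_of_reflY_mem_tri h1, eq_zero_of_reflY_mem_tri h2] at h3
      exact absurd rfl h3
  · rintro ⟨hne, t, ht, h1, h2⟩
    refine Or.inl ⟨n, latPt t, ?_, latPt_mem_tri.2 h1, latPt_mem_tri.2 h2,
      latPt_injective.ne hne⟩
    rw [baseSet_eq_image]
    exact Finset.mem_image_of_mem _ ht

lemma sum_cell (f : ℕ × ℕ → ℝ) (t : ℕ × ℕ) : ∑ v ∈ cell t, f v = cellSum f t := by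
  obtain ⟨i, j⟩ := t
  rw [cell, Finset.sum_insert (by simp), Finset.sum_pair (by simp), cellSum]
  ring

lemma eq_of_mem_cell {v w s t : ℕ × ℕ} (h : v ≠ w) (hvs : v ∈ cell s) (hws : w ∈ cell s)
    (hvt : v ∈ cell t) (hwt : w ∈ cell t) : s = t := by
  simp only [mem_cell, Prod.ext_iff, ne_eq] at *
  omega

lemma sum_adj_eq_latLap {n : ℕ} {v : ℕ × ℕ} (hv : v ∈ verts n) (f : ℕ × ℕ → ℝ) :
    ∑ w ∈ verts n, (if Adj (latPt v) (latPt w) then f v - f w else 0) = latLap n f v := by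
  have h1 : ∀ w ∈ verts n, (if Adj (latPt v) (latPt w) then f v - f w else 0) =
      ∑ t ∈ cellsAt n v, if w ∈ cell t then f v - f w else 0 := by
    intro w hw
    split_ifs with h
    · obtain ⟨hne, t, ht, hvt, hwt⟩ := (adj_latPt_iff hv hw).1 h
      rw [Finset.sum_eq_single_of_mem t (mem_cellsAt.2 ⟨ht, hvt⟩), if_pos hwt]
      intro s hs hst
      exact if_neg fun hws => hst (eq_of_mem_cell hne (mem_cellsAt.1 hs).2 hws hvt hwt)
    · refine (Finset.sum_eq_zero fun t ht => ?_).symm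
      split_ifs with hwt
      · have : v = w := by
          by_contra hne
          exact h ((adj_latPt_iff hv hw).2
            ⟨hne, t, (mem_cellsAt.1 ht).1, (mem_cellsAt.1 ht).2, hwt⟩)
        rw [this, sub_self]
      · rfl
  rw [Finset.sum_congr rfl h1, Finset.sum_comm, latLap]
  refine Finset.sum_congr rfl fun t ht => ?_
  have hsub : cell t ⊆ verts n := fun w hw => mem_verts.2 ⟨t, (mem_cellsAt.1 ht).1, hw⟩
  rw [← Finset.sum_filter, Finset.filter_mem_eq_inter, Finset.inter_eq_right.2 hsub, sum_cell]
  simp only [cellSum]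
  ring

lemma latPt_mem_vtxF {n : ℕ} {v : ℕ × ℕ} : latPt v ∈ VtxF n ↔ v ∈ verts n := by
  rw [vtxF_eq_image, latPt_injective.mem_finset_image]

lemma hMat_mulVec_apply {n : ℕ} {v : ℕ × ℕ} (hv : v ∈ verts n) (g : ℝ × ℝ → ℝ) :
    (HMat 1 (VtxF n) (fun _ => 0)).mulVec (fun y => g y) ⟨latPt v, latPt_mem_vtxF.2 hv⟩ =
      latLap n (g ∘ latPt) v := by
  rw [← sum_adj_eq_latLap hv, Matrix.mulVec, dotProduct]
  simp only [HMat, bcDiag, add_zero, sub_mul, Finset.sum_sub_distrib, Function.comp]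
  rw [Finset.sum_coe_sort (VtxF n)
      (fun y => (if latPt v = y then (degIn (VtxF n) (latPt v) : ℝ) else 0) * g y),
    Finset.sum_coe_sort (VtxF n) (fun y => (if Adj (latPt v) y then (1 : ℝ) else 0) * g y)]
  simp only [ite_mul, zero_mul, one_mul]
  rw [Finset.sum_ite_eq, if_pos (latPt_mem_vtxF.2 hv)]
  have h : (degIn (VtxF n) (latPt v) : ℝ) * g (latPt v) =
      ∑ y ∈ VtxF n, if Adj (latPt v) y then g (latPt v) else 0 := by
    rw [← Finset.sum_filter, Finset.sum_const, nsmul_eq_mul, degIn]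
  rw [h, ← Finset.sum_sub_distrib, vtxF_eq_image,
    Finset.sum_image (fun _ _ _ _ h => latPt_injective h)]
  refine Finset.sum_congr rfl fun w _ => ?_
  split_ifs <;> simp

/-- The harmonic extension of a function on one level to the next finer level. -/
noncomputable def harmExt (h : ℕ × ℕ → ℝ) (p : ℕ × ℕ) : ℝ :=
  if p.1 % 2 = 0 then
    if p.2 % 2 = 0 then h (p.1 / 2, p.2 / 2)
    else (2 * h (p.1 / 2, p.2 / 2) + 2 * h (p.1 / 2, p.2 / 2 + 1) + h (p.1 / 2 + 1, p.2 / 2)) / 5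
  else
    if p.2 % 2 = 0 then
      (2 * h (p.1 / 2, p.2 / 2) + 2 * h (p.1 / 2 + 1, p.2 / 2) + h (p.1 / 2, p.2 / 2 + 1)) / 5
    else
      (2 * h (p.1 / 2 + 1, p.2 / 2) + 2 * h (p.1 / 2, p.2 / 2 + 1) + h (p.1 / 2, p.2 / 2)) / 5

lemma harmExt_even_even (h : ℕ × ℕ → ℝ) (i j : ℕ) : harmExt h (2 * i, 2 * j) = h (i, j) := by
  simp [harmExt]

lemma harmExt_odd_even (h : ℕ × ℕ → ℝ) (i j : ℕ) : harmExt h (2 * i + 1, 2 * j) =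
    (2 * h (i, j) + 2 * h (i + 1, j) + h (i, j + 1)) / 5 := by
  have e1 : (2 * i + 1) % 2 = 1 := by omega
  have e2 : (2 * i + 1) / 2 = i := by omega
  simp [harmExt, e1, e2]

lemma harmExt_even_odd (h : ℕ × ℕ → ℝ) (i j : ℕ) : harmExt h (2 * i, 2 * j + 1) =
    (2 * h (i, j) + 2 * h (i, j + 1) + h (i + 1, j)) / 5 := by
  have e1 : (2 * j + 1) % 2 = 1 := by omega
  have e2 : (2 * j + 1) / 2 = j := by omega
  simp [harmExt, e1, e2]

lemma harmExt_odd_odd (h : ℕ × ℕ → ℝ) (i j : ℕ) : harmExt h (2 * i + 1, 2 * j + 1) =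
    (2 * h (i + 1, j) + 2 * h (i, j + 1) + h (i, j)) / 5 := by
  have e1 : (2 * i + 1) % 2 = 1 := by omega
  have e2 : (2 * i + 1) / 2 = i := by omega
  have e3 : (2 * j + 1) % 2 = 1 := by omega
  have e4 : (2 * j + 1) / 2 = j := by omega
  simp [harmExt, e1, e2, e3, e4]

/-- The harmonic function on `Tₙ` with corner values `0`, `1` and `-1`. -/
noncomputable def harm : ℕ → ℕ × ℕ → ℝ
  | 0 => fun p => p.1 - p.2
  | n + 1 => harmExt (harm n)

lemma harm_swap (n : ℕ) : ∀ p : ℕ × ℕ, harm n p.swap = -harm n p := by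
  induction n with
  | zero => intro p; simp [harm]
  | succ n ih =>
    have ih' (i j : ℕ) : harm n (j, i) = -harm n (i, j) := ih (i, j)
    rintro ⟨i, j⟩
    simp only [harm, harmExt, Prod.swap_prod_mk]
    rw [ih' (i / 2), ih' (i / 2 + 1), ih' (i / 2)]
    split_ifs <;> ring

lemma swap_mem_cells {n : ℕ} : ∀ {t : ℕ × ℕ}, t ∈ cells n → t.swap ∈ cells n := by
  induction n with
  | zero => simp [cells]
  | succ n ih =>
    intro s hs
    obtain ⟨t, ht, h⟩ := mem_cells_succ.1 hs
    refine mem_cells_succ.2 ⟨_, ih ht, ?_⟩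
    simp only [Prod.ext_iff, Prod.fst_swap, Prod.snd_swap] at h ⊢
    omega

lemma swap_mem_verts {n : ℕ} {v : ℕ × ℕ} (hv : v ∈ verts n) : v.swap ∈ verts n := by
  obtain ⟨t, ht, h⟩ := mem_verts.1 hv
  refine mem_verts.2 ⟨_, swap_mem_cells ht, ?_⟩
  simp only [mem_cell, Prod.ext_iff, Prod.fst_swap, Prod.snd_swap] at h ⊢
  omega

lemma sum_verts_harm (n : ℕ) : ∑ v ∈ verts n, harm n v = 0 := by
  have h : ∑ v ∈ verts n, harm n v = ∑ v ∈ verts n, -harm n v :=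
    Finset.sum_nbij' Prod.swap Prod.swap (fun _ => swap_mem_verts) (fun _ => swap_mem_verts)
      (fun _ _ => Prod.swap_swap _) (fun _ _ => Prod.swap_swap _)
      (fun v _ => by rw [harm_swap, neg_neg])
  rw [Finset.sum_neg_distrib] at h
  linarith

lemma sum_cells_succ (n : ℕ) (F : ℕ × ℕ → ℝ) : ∑ s ∈ cells (n + 1), F s =
    ∑ t ∈ cells n, (F (2 * t.1, 2 * t.2) + F (2 * t.1 + 1, 2 * t.2) +
      F (2 * t.1, 2 * t.2 + 1)) := by
  rw [cells, Finset.sum_biUnion]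
  · refine Finset.sum_congr rfl fun t _ => ?_
    rw [Finset.sum_insert (by simp), Finset.sum_pair (by simp), add_assoc]
  · intro s _ t _ hst
    refine Finset.disjoint_left.2 fun w hs ht => hst ?_
    simp only [Finset.mem_insert, Finset.mem_singleton, Prod.ext_iff] at hs ht ⊢
    omega

/-- The Dirichlet energy of `f` on a unit triangle. -/
def cellEnergy (f : ℕ × ℕ → ℝ) (t : ℕ × ℕ) : ℝ :=
  (f t - f (t.1 + 1, t.2)) ^ 2 + (f t - f (t.1, t.2 + 1)) ^ 2 +
    (f (t.1 + 1, t.2) - f (t.1, t.2 + 1)) ^ 2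

lemma sum_cellEnergy_harm (n : ℕ) :
    ∑ t ∈ cells n, cellEnergy (harm n) t = 6 * (3 / 5 : ℝ) ^ n := by
  induction n with
  | zero => norm_num [cells, cellEnergy, harm]
  | succ n ih =>
    rw [sum_cells_succ, pow_succ, ← mul_assoc, ← ih, Finset.sum_mul]
    refine Finset.sum_congr rfl fun t _ => ?_
    simp only [cellEnergy, harm]
    rw [show 2 * t.1 + 1 + 1 = 2 * (t.1 + 1) by ring, show 2 * t.2 + 1 + 1 = 2 * (t.2 + 1) by ring]
    simp only [harmExt_even_even, harmExt_even_odd, harmExt_odd_even, harmExt_odd_odd]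
    ring

lemma sum_cellSum_harm_sq (n : ℕ) : ∑ t ∈ cells n, cellSum (fun v => harm n v ^ 2) t =
    2 / 5 * 3 ^ n + 8 / 5 * (3 / 5 : ℝ) ^ n := by
  induction n with
  | zero => norm_num [cells, cellSum, harm]
  | succ n ih =>
    have h : ∑ s ∈ cells (n + 1), cellSum (fun v => harm (n + 1) v ^ 2) s =
        ∑ t ∈ cells n, (3 * cellSum (fun v => harm n v ^ 2) t -
          16 / 25 * cellEnergy (harm n) t) := by
      rw [sum_cells_succ]
      refine Finset.sum_congr rfl fun t _ => ?_
      simp only [cellSum, cellEnergy, harm]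
      rw [show 2 * t.1 + 1 + 1 = 2 * (t.1 + 1) by ring,
        show 2 * t.2 + 1 + 1 = 2 * (t.2 + 1) by ring]
      simp only [harmExt_even_even, harmExt_even_odd, harmExt_odd_even, harmExt_odd_odd]
      ring
    rw [h, Finset.sum_sub_distrib, ← Finset.mul_sum, ← Finset.mul_sum, ih, sum_cellEnergy_harm]
    ring

lemma sum_verts_sum_cellsAt (n : ℕ) (F : ℕ × ℕ → ℕ × ℕ → ℝ) :
    ∑ v ∈ verts n, ∑ t ∈ cellsAt n v, F v t = ∑ t ∈ cells n, ∑ v ∈ cell t, F v t := by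
  refine Finset.sum_comm' fun v t => ?_
  rw [mem_cellsAt]
  exact ⟨fun h => ⟨h.2.2, h.2.1⟩, fun h => ⟨mem_verts.2 ⟨t, h.2, h.1⟩, h.2, h.1⟩⟩

lemma sum_mul_latLap (n : ℕ) (f : ℕ × ℕ → ℝ) :
    ∑ v ∈ verts n, f v * latLap n f v = ∑ t ∈ cells n, cellEnergy f t := by
  simp only [latLap, Finset.mul_sum]
  rw [sum_verts_sum_cellsAt]
  refine Finset.sum_congr rfl fun t _ => ?_
  rw [sum_cell (fun v => f v * (3 * f v - cellSum f t))]
  simp only [cellSum, cellEnergy]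
  ring

lemma le_sum_verts_harm_sq (n : ℕ) : (1 / 5 : ℝ) * 3 ^ n ≤ ∑ v ∈ verts n, harm n v ^ 2 := by
  have h1 : ∑ t ∈ cells n, cellSum (fun v => harm n v ^ 2) t =
      ∑ v ∈ verts n, (cellsAt n v).card * harm n v ^ 2 := by
    simp only [← sum_cell]
    rw [← sum_verts_sum_cellsAt n fun v _ => harm n v ^ 2]
    simp
  have h2 : ∑ v ∈ verts n, (cellsAt n v).card * harm n v ^ 2 ≤
      ∑ v ∈ verts n, 2 * harm n v ^ 2 := by
    refine Finset.sum_le_sum fun v hv => ?_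
    have : ((cellsAt n v).card : ℝ) ≤ 2 := by exact_mod_cast card_cellsAt_le n v hv
    gcongr
  rw [← h1, sum_cellSum_harm_sq, ← Finset.mul_sum] at h2
  have : (0 : ℝ) < (3 / 5) ^ n := by positivity
  linarith

lemma sum_harm_mul_latLap_le (n : ℕ) :
    ∑ v ∈ verts n, harm n v * latLap n (harm n) v ≤
      30 * (1 / 5 : ℝ) ^ n * ∑ v ∈ verts n, harm n v ^ 2 := by
  rw [sum_mul_latLap, sum_cellEnergy_harm]
  have h := mul_le_mul_of_nonneg_left (le_sum_verts_harm_sq n)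
    (show (0 : ℝ) ≤ 30 * (1 / 5) ^ n by positivity)
  have e : (3 / 5 : ℝ) ^ n = (1 / 5) ^ n * 3 ^ n := by
    rw [← mul_pow]
    norm_num
  rw [e]
  linarith

lemma exists_eigenvalue_le {ι : Type*} [Fintype ι] [DecidableEq ι] {A : Matrix ι ι ℝ}
    (hA : A.IsHermitian) {h : ι → ℝ} {r : ℝ} (h0 : h ≠ 0)
    (horth : ∀ u : ι → ℝ, A.mulVec u = 0 → u ⬝ᵥ h = 0)
    (hle : h ⬝ᵥ A.mulVec h ≤ r * (h ⬝ᵥ h)) :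
    ∃ μ, Module.End.HasEigenvalue A.mulVecLin μ ∧ μ ≠ 0 ∧ μ ≤ r := by
  set b := hA.eigenvectorBasis
  set c : ι → ℝ := fun i => (b i : ι → ℝ) ⬝ᵥ h with hc
  have parseval : ∀ y : ι → ℝ, h ⬝ᵥ y = ∑ i, c i * ((b i : ι → ℝ) ⬝ᵥ y) := by
    intro y
    have := b.sum_inner_mul_inner (WithLp.toLp 2 h) (WithLp.toLp 2 y)
    simp only [EuclideanSpace.inner_eq_star_dotProduct, star_trivial] at this
    rw [dotProduct_comm, ← this]
    exact Finset.sum_congr rfl fun i _ => by rw [dotProduct_comm y]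
  have hT : A.transpose = A := A.conjTranspose_eq_transpose_of_trivial.symm.trans hA
  have hbA : ∀ i, (b i : ι → ℝ) ⬝ᵥ A.mulVec h = hA.eigenvalues i * c i := by
    intro i
    rw [Matrix.dotProduct_mulVec, ← Matrix.mulVec_transpose, hT, hA.mulVec_eigenvectorBasis,
      smul_dotProduct, smul_eq_mul]
  by_contra! hcon
  have heig : ∀ i, hA.eigenvalues i ≠ 0 → r < hA.eigenvalues i := by
    intro i hi
    refine hcon _ ?_ hi
    refine Module.End.hasEigenvalue_of_hasEigenvector (x := (b i : ι → ℝ))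
      (Module.End.hasEigenvector_iff.2 ⟨Module.End.mem_eigenspace_iff.2 ?_, ?_⟩)
    · exact hA.mulVec_eigenvectorBasis i
    · intro hz
      apply b.orthonormal.ne_zero i
      ext j
      exact congrFun hz j
  have hterm : ∀ i, 0 ≤ (hA.eigenvalues i - r) * c i ^ 2 ∧
      ((hA.eigenvalues i - r) * c i ^ 2 = 0 → c i = 0) := by
    intro i
    by_cases hi : hA.eigenvalues i = 0
    · have : c i = 0 := by
        apply horth
        rw [hA.mulVec_eigenvectorBasis, hi, zero_smul]
      simp [this]
    · have := sub_pos.2 (heig i hi)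
      refine ⟨by positivity, fun h => ?_⟩
      simpa [this.ne'] using h
  have hsum : ∑ i, (hA.eigenvalues i - r) * c i ^ 2 ≤ 0 := by
    rw [parseval, parseval h, Finset.mul_sum, ← sub_nonpos, ← Finset.sum_sub_distrib] at hle
    refine le_trans (le_of_eq (Finset.sum_congr rfl fun i _ => ?_)) hle
    rw [hbA]
    ring
  have hz := (Finset.sum_eq_zero_iff_of_nonneg fun i _ => (hterm i).1).1
    (le_antisymm hsum (Finset.sum_nonneg fun i _ => (hterm i).1))
  apply h0
  rw [← dotProduct_self_eq_zero, parseval]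
  exact Finset.sum_eq_zero fun i hi => by rw [(hterm i).2 (hz i hi), zero_mul]

lemma adj_symm {x y : ℝ × ℝ} (h : Adj x y) : Adj y x := by
  rcases h with ⟨n, t, ht, h1, h2, h3⟩ | ⟨n, t, ht, h1, h2, h3⟩
  · exact Or.inl ⟨n, t, ht, h2, h1, h3.symm⟩
  · exact Or.inr ⟨n, t, ht, h2, h1, h3.symm⟩

lemma hMat_isHermitian (b : Fin 3) (A : Finset (ℝ × ℝ)) (V : ℝ × ℝ → ℝ) :
    (HMat b A V).IsHermitian := by
  ext x y
  have h : Adj (y : ℝ × ℝ) x ↔ Adj (x : ℝ × ℝ) y := ⟨adj_symm, adj_symm⟩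
  by_cases hxy : x = y
  · simp [hxy, HMat]
  · have h1 : (x : ℝ × ℝ) ≠ y := fun e => hxy (Subtype.ext e)
    simp [HMat, h, h1, h1.symm]

lemma sum_vtxF (n : ℕ) (g : ℝ × ℝ → ℝ) : ∑ y : VtxF n, g y = ∑ v ∈ verts n, g (latPt v) := by
  rw [Finset.sum_coe_sort, vtxF_eq_image, Finset.sum_image fun _ _ _ _ h => latPt_injective h]

lemma exists_extension {A : Finset (ℝ × ℝ)} (f : A → ℝ) :
    ∃ g : ℝ × ℝ → ℝ, f = fun y : A => g y :=
  ⟨fun y => if h : y ∈ A then f ⟨y, h⟩ else 0, by ext y; simp⟩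

lemma cornerEigen_of_mulVec {n : ℕ} {μ : ℝ} {g : ℝ × ℝ → ℝ}
    (h : (HMat 1 (VtxF n) (fun _ => 0)).mulVec (fun y => g y) = μ • fun y : VtxF n => g y) :
    CornerEigen n μ (1 / 2) (g ∘ latPt) := by
  intro v hv
  rw [← hMat_mulVec_apply hv, h]
  simp only [Pi.smul_apply, smul_eq_mul, Function.comp]
  ring

lemma exists_cornerEigen {n : ℕ} {μ : ℝ}
    (h : Module.End.HasEigenvalue (Matrix.mulVecLin (HMat 1 (VtxF n) (fun _ => 0))) μ) :
    ∃ F : ℕ × ℕ → ℝ, CornerEigen n μ (1 / 2) F ∧ ∃ v ∈ verts n, F v ≠ 0 := by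
  obtain ⟨f, hf⟩ := h.exists_hasEigenvector
  obtain ⟨g, rfl⟩ := exists_extension f
  refine ⟨g ∘ latPt, cornerEigen_of_mulVec hf.apply_eq_smul, ?_⟩
  by_contra! hz
  apply hf.2
  ext ⟨y, hy⟩
  obtain ⟨v, hv, rfl⟩ := Finset.mem_image.1 (vtxF_eq_image n ▸ hy)
  exact hz v hv

lemma cornerEigen_nonneg {n : ℕ} {μ : ℝ} {F : ℕ × ℕ → ℝ} (hF : CornerEigen n μ (1 / 2) F)
    (h : ∃ v ∈ verts n, F v ≠ 0) : 0 ≤ μ := by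
  have h1 : μ * ∑ v ∈ verts n, F v ^ 2 = ∑ t ∈ cells n, cellEnergy F t := by
    rw [← sum_mul_latLap, Finset.mul_sum]
    refine Finset.sum_congr rfl fun v hv => ?_
    rw [hF v hv]
    ring
  have h2 : 0 ≤ ∑ t ∈ cells n, cellEnergy F t :=
    Finset.sum_nonneg fun t _ => by unfold cellEnergy; positivity
  have h3 : 0 < ∑ v ∈ verts n, F v ^ 2 := by
    obtain ⟨v, hv, hne⟩ := h
    exact Finset.sum_pos' (fun v _ => sq_nonneg _) ⟨v, hv, by positivity⟩
  rw [← h1] at h2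
  exact nonneg_of_mul_nonneg_left h2 h3

lemma hasEigenvalue_zero (n : ℕ) :
    Module.End.HasEigenvalue (Matrix.mulVecLin (HMat 1 (VtxF n) (fun _ => 0))) 0 := by
  have hne : (0, 0) ∈ verts n :=
    mem_verts.2 ⟨(0, 0), cells_mono (Nat.zero_le n) (by simp [cells]), by simp [mem_cell]⟩
  refine Module.End.hasEigenvalue_of_hasEigenvector (x := fun _ => 1)
      (Module.End.hasEigenvector_iff.2 ⟨Module.End.mem_eigenspace_iff.2 ?_, ?_⟩)
  · ext ⟨y, hy⟩
    obtain ⟨v, hv, rfl⟩ := Finset.mem_image.1 (vtxF_eq_image n ▸ hy)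
    refine (hMat_mulVec_apply hv fun _ => 1).trans ?_
    rw [zero_smul, Pi.zero_apply]
    refine Finset.sum_eq_zero fun t _ => ?_
    norm_num [cellSum]
  · intro h
    exact one_ne_zero (congrFun h ⟨_, latPt_mem_vtxF.2 hne⟩)

lemma exists_small_eigenvalue (n : ℕ) : ∃ μ,
    Module.End.HasEigenvalue (Matrix.mulVecLin (HMat 1 (VtxF n) (fun _ => 0))) μ ∧ μ ≠ 0 ∧
      μ ≤ 30 * (1 / 5 : ℝ) ^ n := by
  set g : ℝ × ℝ → ℝ := harm n ∘ Function.invFun latPt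
  have hg : ∀ v, g (latPt v) = harm n v := fun v => by
    simp [g, Function.leftInverse_invFun latPt_injective v]
  have hg' : g ∘ latPt = harm n := funext hg
  have hsq : (fun y : VtxF n => g y) ⬝ᵥ (fun y : VtxF n => g y) = ∑ v ∈ verts n, harm n v ^ 2 := by
    rw [dotProduct, sum_vtxF n fun y => g y * g y]
    simp only [hg, sq]
  refine exists_eigenvalue_le (hMat_isHermitian _ _ _) (h := fun y => g y) ?_ ?_ ?_
  · intro hz
    rw [← dotProduct_self_eq_zero, hsq] at hz
    have := le_sum_verts_harm_sq n
    have : (0 : ℝ) < 3 ^ n := by positivity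
    linarith
  · intro u hu
    obtain ⟨k, rfl⟩ := exists_extension u
    have hk := (cornerEigen_of_mulVec (μ := 0) (hu.trans (zero_smul _ _).symm)).const_of_zero
    rw [dotProduct, sum_vtxF n fun y => k y * g y]
    have : ∀ v ∈ verts n, k (latPt v) * g (latPt v) = k (latPt (0, 0)) * harm n v := by
      intro v hv
      rw [hg, show k (latPt v) = k (latPt (0, 0)) from hk v hv]
    rw [Finset.sum_congr rfl this, ← Finset.mul_sum, sum_verts_harm, mul_zero]
  · obtain ⟨k, hk⟩ := exists_extension ((HMat 1 (VtxF n) fun _ => 0).mulVec fun y => g y)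
    rw [hsq, hk, dotProduct, sum_vtxF n fun y => g y * k y]
    refine le_trans (le_of_eq (Finset.sum_congr rfl fun v hv => ?_)) (sum_harm_mul_latLap_le n)
    rw [hg, ← hg', ← hMat_mulVec_apply hv, hk]

lemma two_rpow_neg_mul_log (n : ℕ) :
    (2 : ℝ) ^ (-(n : ℝ) * (Real.log 5 / Real.log 2)) = (1 / 5) ^ n := by
  have h2 : Real.log 2 ≠ 0 := (Real.log_pos (by norm_num)).ne'
  rw [Real.rpow_def_of_pos (by norm_num),
    show Real.log 2 * (-(n : ℝ) * (Real.log 5 / Real.log 2)) = n * -Real.log 5 by field_simp,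
    Real.exp_nat_mul, Real.exp_neg, Real.exp_log (by norm_num), one_div]

end SGL

open SGL

/-- For `ℓ ≥ 1` and `β = log 5 / log 2`, the smallest eigenvalue of the
Neumann Laplacian `−Δ^{𝔾_ℓ,N}` is `0`, and its smallest non-zero eigenvalue `E₁` satisfies
`(15/2)·2^{−ℓβ} ≤ E₁ ≤ 60·2^{−ℓβ}`. -/
theorem neumann_spectral_gap (ℓ : ℕ) (hℓ : 1 ≤ ℓ) :
    Module.End.HasEigenvalue
        (Matrix.mulVecLin (HMat 1 (VtxF ℓ) (fun _ => 0))) 0 ∧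
      (∀ μ : ℝ, Module.End.HasEigenvalue
          (Matrix.mulVecLin (HMat 1 (VtxF ℓ) (fun _ => 0))) μ → 0 ≤ μ) ∧
      ∃ E₁ : ℝ,
        Module.End.HasEigenvalue
          (Matrix.mulVecLin (HMat 1 (VtxF ℓ) (fun _ => 0))) E₁ ∧
        E₁ ≠ 0 ∧
        (∀ μ : ℝ, Module.End.HasEigenvalue
            (Matrix.mulVecLin (HMat 1 (VtxF ℓ) (fun _ => 0))) μ → μ ≠ 0 → E₁ ≤ μ) ∧
        (15 / 2) * (2 : ℝ) ^ (-(ℓ : ℝ) * (Real.log 5 / Real.log 2)) ≤ E₁ ∧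
        E₁ ≤ 60 * (2 : ℝ) ^ (-(ℓ : ℝ) * (Real.log 5 / Real.log 2)) := by
  refine ⟨hasEigenvalue_zero ℓ, ?_, ?_⟩
  · intro μ hμ
    obtain ⟨F, hF, hne⟩ := exists_cornerEigen hμ
    exact cornerEigen_nonneg hF hne
  set S : Set ℝ := {μ | Module.End.HasEigenvalue
    (Matrix.mulVecLin (HMat 1 (VtxF ℓ) (fun _ => 0))) μ ∧ μ ≠ 0}
  obtain ⟨μ₀, hμ₀, hμ₀', hle⟩ := exists_small_eigenvalue ℓ
  have hfin : S.Finite := (Module.End.finite_hasEigenvalue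
    (Matrix.mulVecLin (HMat 1 (VtxF ℓ) (fun _ => 0)))).subset fun _ h => h.1
  obtain ⟨E, ⟨hE, hE0⟩, hmin⟩ := Set.exists_min_image S id hfin ⟨μ₀, hμ₀, hμ₀'⟩
  have hp : (0 : ℝ) < (1 / 5) ^ ℓ := by positivity
  rw [two_rpow_neg_mul_log]
  refine ⟨E, hE, hE0, fun μ h h' => hmin μ ⟨h, h'⟩, ?_, ?_⟩
  · obtain ⟨F, hF, hne⟩ := exists_cornerEigen hE
    have hpos := lt_of_le_of_ne (cornerEigen_nonneg hF hne) hE0.symm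
    obtain ⟨n, rfl⟩ := Nat.exists_eq_add_of_le' hℓ
    have := hF.le_eigenvalue hpos (by norm_num) le_rfl hne
    rw [pow_succ]
    linarith
  · have := hmin μ₀ ⟨hμ₀, hμ₀'⟩
    simp only [id] at this
    linarith
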